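/- Let δ > 0, let m₋ ≥ 1 and m₊ ≥ 1 be natural numbers, and let ℓ₋ : Fin m₋ → ℝ and ℓ₊ : Fin m₊ → ℝ be lifetime vectors with all coordinates positive. Assume there exists an index i⋆ with ℓ₋ i⋆ ≥ δ and ℓ₋ i⋆ < ∑ i, ℓ₋ i, and that PE(ℓ₊) < -p⋆ * Real.log p⋆, where p⋆ = ℓ₋ i⋆ / ∑ i, ℓ₋ i. Let (Ω, μ) be a probability space and let X_N⁻ : Ω → (Fin m₋ → ℝ) and X_N⁺ : Ω → (Fin m₊ → ℝ) be sequences of measurable maps converging in probability to the constants ℓ₋ and ℓ₊ respectively. Then there exists a threshold θ ∈ ℝ such that μ {ω | PE(X_N⁻ ω) ≥ θ} → 1 and μ {ω | PE(X_N⁺ ω) < θ} → 1 as N → ∞; that is, thresholding persistent entropy yields an asymptotically consistent classifier of the two phases. -/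

import Mathlib

open MeasureTheory Filter Topology

/-- Persistent entropy of a lifetime vector: Shannon entropy of the normalized
lifetime distribution (with Lean's total division). -/
noncomputable def PE {m : ℕ} (ℓ : Fin m → ℝ) : ℝ :=
  -∑ i, (ℓ i / ∑ j, ℓ j) * Real.log (ℓ i / ∑ j, ℓ j)

/-- If `X N` converges in probability to the constant `x₀`, then the probability that `X N` lies in
a given neighbourhood of `x₀` tends to one. -/
theorem tendsto_measure_preimage_nhds_of_tendstoInMeasure_const
    {Ω E ι : Type*} [MeasurableSpace Ω] [PseudoMetricSpace E] {μ : Measure Ω}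
    [IsProbabilityMeasure μ] {l : Filter ι} {X : ι → Ω → E} {x₀ : E}
    (h : TendstoInMeasure μ X l (fun _ => x₀)) {s : Set E} (hs : s ∈ 𝓝 x₀) :
    Tendsto (fun N => μ {ω | X N ω ∈ s}) l (𝓝 1) := by
  obtain ⟨ε, hε, hball⟩ := Metric.mem_nhds_iff.1 hs
  have hlim : Tendsto (fun N => 1 - μ {ω | ε ≤ dist (X N ω) x₀}) l (𝓝 1) := by
    simpa using ENNReal.Tendsto.sub tendsto_const_nhds (tendstoInMeasure_iff_dist.1 h ε hε)
      (Or.inl ENNReal.one_ne_top)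
  refine tendsto_of_tendsto_of_tendsto_of_le_of_le hlim tendsto_const_nhds (fun N => ?_)
    (fun N => prob_le_one)
  refine tsub_le_iff_right.2 ?_
  rw [← measure_univ (μ := μ)]
  refine (measure_mono fun ω _ => ?_).trans (measure_union_le _ _)
  rcases lt_or_ge (dist (X N ω) x₀) ε with hω | hω
  · exact Or.inl (hball hω)
  · exact Or.inr hω

theorem PE_eq_sum_negMulLog {m : ℕ} (ℓ : Fin m → ℝ) :
    PE ℓ = ∑ i, Real.negMulLog (ℓ i / ∑ j, ℓ j) := by
  simp [PE, Real.negMulLog]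

/-- Persistent entropy is continuous at every lifetime vector of nonzero total. -/
theorem continuousAt_PE {m : ℕ} {ℓ : Fin m → ℝ} (hℓ : ∑ i, ℓ i ≠ 0) : ContinuousAt PE ℓ := by
  rw [funext PE_eq_sum_negMulLog]
  refine tendsto_finsetSum _ fun i _ => Real.continuous_negMulLog.continuousAt.tendsto.comp ?_
  exact (continuous_apply i).continuousAt.div (by fun_prop) hℓ

/-- Persistent entropy dominates each of its summands. -/
theorem negMulLog_le_PE {m : ℕ} {ℓ : Fin m → ℝ} (hℓ : ∀ i, 0 ≤ ℓ i) (i : Fin m) :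
    Real.negMulLog (ℓ i / ∑ j, ℓ j) ≤ PE ℓ := by
  rw [PE_eq_sum_negMulLog]
  have hsum : 0 ≤ ∑ j, ℓ j := Finset.sum_nonneg fun j _ => hℓ j
  refine Finset.single_le_sum (f := fun i => Real.negMulLog (ℓ i / ∑ j, ℓ j))
    (fun j _ => Real.negMulLog_nonneg (div_nonneg (hℓ j) hsum) ?_) (Finset.mem_univ i)
  exact div_le_one_of_le₀ (Finset.single_le_sum (fun k _ => hℓ k) (Finset.mem_univ j)) hsum

/-- Thresholding persistent entropy yields an asymptotically consistent
classifier of the two phases. -/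
theorem persistent_entropy_threshold_classifier
    {Ω : Type*} [MeasurableSpace Ω] (μ : Measure Ω) [IsProbabilityMeasure μ]
    (δ : ℝ) (hδ : 0 < δ) (mneg mpos : ℕ) (hmneg : 1 ≤ mneg) (hmpos : 1 ≤ mpos)
    (ℓneg : Fin mneg → ℝ) (ℓpos : Fin mpos → ℝ)
    (hposneg : ∀ i, 0 < ℓneg i) (hpospos : ∀ i, 0 < ℓpos i)
    (istar : Fin mneg) (histar : δ ≤ ℓneg istar) (hlt : ℓneg istar < ∑ i, ℓneg i)
    (hPEpos : PE ℓpos <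
      -(ℓneg istar / ∑ i, ℓneg i) * Real.log (ℓneg istar / ∑ i, ℓneg i))
    (Xneg : ℕ → Ω → (Fin mneg → ℝ)) (Xpos : ℕ → Ω → (Fin mpos → ℝ))
    (hmeasneg : ∀ N, Measurable (Xneg N)) (hmeaspos : ∀ N, Measurable (Xpos N))
    (hconvneg : TendstoInMeasure μ Xneg atTop (fun _ => ℓneg))
    (hconvpos : TendstoInMeasure μ Xpos atTop (fun _ => ℓpos)) :
    ∃ θ : ℝ,
      Tendsto (fun N => μ {ω | θ ≤ PE (Xneg N ω)}) atTop (𝓝 1) ∧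
      Tendsto (fun N => μ {ω | PE (Xpos N ω) < θ}) atTop (𝓝 1) := by
  have hsum_neg : 0 < ∑ i, ℓneg i := (hposneg istar).trans hlt
  have hsum_pos : 0 < ∑ i, ℓpos i :=
    Finset.sum_pos (fun i _ => hpospos i) ⟨⟨0, hmpos⟩, Finset.mem_univ _⟩
  have hlt_PE : PE ℓpos < PE ℓneg :=
    hPEpos.trans_le (negMulLog_le_PE (fun i => (hposneg i).le) istar)
  obtain ⟨θ, hθpos, hθneg⟩ := exists_between hlt_PE
  exact ⟨θ,
    tendsto_measure_preimage_nhds_of_tendstoInMeasure_const hconvneg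
      ((continuousAt_PE hsum_neg.ne').eventually (eventually_ge_nhds hθneg)),
    tendsto_measure_preimage_nhds_of_tendstoInMeasure_const hconvpos
      ((continuousAt_PE hsum_pos.ne').eventually (eventually_lt_nhds hθpos))⟩
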